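/- arXiv:math/0308249 — 2 statements merged into one kernel-verified Lean document; each statement's English description precedes it below -/
import Mathlib

section
/- For every real l > 0 and every real C, there exist real numbers m < 0 and q > 0 such that, setting r₊ = m + √(m² + q²), one has r₊ > 0, the period constraint 2π r₊² / (r₊ − m) = l holds, and the mass value (1/2) · m · (r₊ − m) / (2π r₊²) is strictly less than C. (In particular, for a fixed asymptotic circle size l, the Kaluza–Klein mass of the analytically continued Reissner–Nordström solution can be made arbitrarily negative.) -/
/-- For every circle size `l > 0` and every bound `C`, there are parameters `m < 0` and
`q > 0` such that, with `r₊ = m + √(m² + q²)`, we have `r₊ > 0`, the period constraint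
`2π r₊² / (r₊ − m) = l` holds, and the Kaluza–Klein mass
`(1/2) · m · (r₊ − m) / (2π r₊²)` is below `C`. -/
theorem RN_mass_arbitrarily_negative (l C : ℝ) (hl : 0 < l) :
    ∃ m q : ℝ, m < 0 ∧ 0 < q ∧
      0 < m + Real.sqrt (m ^ 2 + q ^ 2) ∧
      2 * Real.pi * (m + Real.sqrt (m ^ 2 + q ^ 2)) ^ 2 /
          ((m + Real.sqrt (m ^ 2 + q ^ 2)) - m) = l ∧
      (1 / 2) * m * ((m + Real.sqrt (m ^ 2 + q ^ 2)) - m) /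
          (2 * Real.pi * (m + Real.sqrt (m ^ 2 + q ^ 2)) ^ 2) < C := by
  obtain ⟨r, hr⟩ : ∃ r, r = l * (1 + 2 * |C|) := ⟨_, rfl⟩
  have hlr : l ≤ r := by
    rw [hr]
    nlinarith [mul_nonneg hl.le (abs_nonneg C)]
  have hr0 : 0 < r := hl.trans_le hlr
  have hπ := Real.pi_gt_three
  obtain ⟨s, hs⟩ : ∃ s, s = 2 * Real.pi * r ^ 2 / l := ⟨_, rfl⟩
  have hsl : s * l = 2 * Real.pi * r ^ 2 := by
    rw [hs]
    field_simp
  have hs2 : 2 * r ≤ s := by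
    rw [hs, le_div_iff₀ hl]
    nlinarith [mul_le_mul_of_nonneg_left hlr hr0.le,
      mul_pos (sub_pos.2 hπ) (pow_pos hr0 2)]
  have hs0 : 0 < s := by linarith
  have hq : 0 < r * (2 * s - r) := mul_pos hr0 (by linarith)
  have hsqrt : Real.sqrt ((r - s) ^ 2 + Real.sqrt (r * (2 * s - r)) ^ 2) = s := by
    rw [Real.sq_sqrt hq.le, show (r - s) ^ 2 + r * (2 * s - r) = s ^ 2 by ring,
      Real.sqrt_sq hs0.le]
  refine ⟨r - s, Real.sqrt (r * (2 * s - r)), by linarith, Real.sqrt_pos.2 hq, ?_⟩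
  rw [hsqrt, sub_add_cancel, sub_sub_cancel, ← hsl]
  refine ⟨hr0, by field_simp, ?_⟩
  rw [div_lt_iff₀ (by positivity)]
  have hC : (r - s) / 2 < C * l := by
    nlinarith [mul_nonneg hl.le (neg_le_iff_add_nonneg.1 (neg_abs_le C))]
  nlinarith [mul_lt_mul_of_pos_right hC hs0]
end

section
/- For every real l > 0 and every real Q > 0 there exists M > 0 such that: for all real m ≤ −M and all real q with 0 < q ≤ Q, setting r₊ = m + √(m² + q²), the period constraint 2π r₊² = l · (r₊ − m) fails. (Equivalently, any solution (m, q) of the constraint with m sufficiently negative necessarily has q > Q; the charge must become large along with |m|.) -/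
/-- For every `l > 0` and `Q > 0` there is `M > 0` such that for all `m ≤ −M` and
`0 < q ≤ Q`, setting `r₊ = m + √(m² + q²)`, the constraint `2π r₊² = l (r₊ − m)` fails. -/
theorem RN_charge_must_be_large (l Q : ℝ) (hl : 0 < l) (hQ : 0 < Q) :
    ∃ M : ℝ, 0 < M ∧ ∀ m q : ℝ, m ≤ -M → 0 < q → q ≤ Q →
      2 * Real.pi * (m + Real.sqrt (m ^ 2 + q ^ 2)) ^ 2 ≠
        l * ((m + Real.sqrt (m ^ 2 + q ^ 2)) - m) := by
  refine ⟨2 * Real.pi * Q ^ 2 / l + 1, by positivity, fun m q hm hq hqQ => ne_of_lt ?_⟩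
  have hm_neg : m ≤ 0 := hm.trans (neg_nonpos.mpr (by positivity))
  have hs_lower : -m ≤ √(m ^ 2 + q ^ 2) := Real.le_sqrt_of_sq_le (by nlinarith)
  have hs_upper : √(m ^ 2 + q ^ 2) ≤ q - m :=
    Real.sqrt_le_iff.mpr ⟨by linarith, by nlinarith⟩
  calc
    2 * Real.pi * (m + √(m ^ 2 + q ^ 2)) ^ 2 ≤ 2 * Real.pi * Q ^ 2 := by
      gcongr
      · linarith
      · linarith
    _ = l * (2 * Real.pi * Q ^ 2 / l) := by field_simp
    _ < l * ((m + √(m ^ 2 + q ^ 2)) - m) := by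
      gcongr
      linarith
end
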